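/- Let E: 0 → E^0 → ... → E^n → 0 be a complex of graded free S-modules and F a graded free resolution of a finitely generated graded S-module M. Suppose M and the cohomology modules H^j(E) for j > 0 have finite length, and suppose 0 > reg(M) + reg(E^0) and 0 > reg(F_{j−1}) + reg(H^j(E)) for every j > 0. Then ⟨F, E⟩ = 0. -/

import Mathlib

open MvPolynomial Finset Module

noncomputable section

/-- The standard graded polynomial ring `S = K[x_1, …, x_n]`. -/
abbrev PolyS (K : Type) [Field K] (n : ℕ) : Type := MvPolynomial (Fin n) K

/-- The `K`-subspace of homogeneous polynomials of integer degree `z`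
(it is `0` if `z < 0`). -/
def homogZ (K : Type) [Field K] (n : ℕ) (z : ℤ) : Submodule K (PolyS K n) :=
  ⨆ (_ : 0 ≤ z), MvPolynomial.homogeneousSubmodule (Fin n) K z.toNat

/-- The degree-`ℓ` piece of the graded free module `⊕ₚ S(-dg p)`. -/
def freePiece {K : Type} [Field K] {n r : ℕ} (dg : Fin r → ℤ) (ℓ : ℤ) :
    Submodule K (Fin r → PolyS K n) :=
  Submodule.pi Set.univ fun p => homogZ K n (ℓ - dg p)

/-- A (homologically indexed) finite complex of graded free `S`-modules
`F₀ ← F₁ ← ⋯ ← F_len ← 0`, where `Fᵢ = ⊕ₚ S(-deg i p)` and the (degree `0`)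
map `Fᵢ₊₁ → Fᵢ` is given by the matrix `dd i`, whose entries are homogeneous
of the appropriate degrees. -/
structure FreeComplex (K : Type) [Field K] (n : ℕ) where
  len : ℕ
  rk : ℕ → ℕ
  deg : (i : ℕ) → Fin (rk i) → ℤ
  dd : (i : ℕ) → Matrix (Fin (rk i)) (Fin (rk (i+1))) (PolyS K n)
  rk_eq_zero : ∀ i, len < i → rk i = 0
  isHomog : ∀ i p q, dd i p q ∈ homogZ K n (deg (i+1) q - deg i p)
  isComplex : ∀ i, dd i * dd (i+1) = 0

variable {K : Type} [Field K] {n : ℕ}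

/-- `F` is exact in positive homological degrees; that is, it is a graded free
resolution of the finitely generated graded module `M = coker (F₁ → F₀)`. -/
def IsResolution (F : FreeComplex K n) : Prop :=
  ∀ i, LinearMap.ker ((F.dd i).mulVecLin) = LinearMap.range ((F.dd (i+1)).mulVecLin)

/-- The complex is minimal: entries of the differentials lie in the maximal ideal,
i.e. all (constant) entries between generators of equal degrees vanish. -/
def IsMinimal (F : FreeComplex K n) : Prop :=
  ∀ i p q, F.deg (i+1) q = F.deg i p → F.dd i p q = 0

/-- Betti number `β_{i,j}`: the number of generators of `Fᵢ` of degree `j`. -/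
def bettiNum (F : FreeComplex K n) (i : ℕ) (j : ℤ) : ℕ :=
  (Finset.univ.filter fun p => F.deg i p = j).card

/-- The dimension of the degree-`ℓ` piece of the module `M = coker (F₁ → F₀)`
resolved by `F`. -/
def MPieceDim (F : FreeComplex K n) (ℓ : ℤ) : ℕ :=
  finrank K ((freePiece (F.deg 0) ℓ) ⧸
    (Submodule.comap (freePiece (F.deg 0) ℓ).subtype
      ((LinearMap.range ((F.dd 0).mulVecLin)).restrictScalars K)))

/-- The Hilbert polynomial of the twisted free module `S(-a)` in `n` variables:
`binom (t - a + n - 1, n - 1)`. -/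
def genHilb (n : ℕ) (a : ℤ) : Polynomial ℚ :=
  if n = 0 then 0 else
    Polynomial.C (((n - 1).factorial : ℚ))⁻¹ *
      ∏ k ∈ Finset.range (n - 1),
        (Polynomial.X - Polynomial.C (a : ℚ) + Polynomial.C ((k : ℚ) + 1))

/-- The Hilbert polynomial of `M = coker (F₁ → F₀)`, computed from the free
resolution `F` by additivity. -/
def hilbPoly (F : FreeComplex K n) : Polynomial ℚ :=
  ∑ i ∈ Finset.range (F.len + 1),
    Polynomial.C ((-1 : ℚ) ^ i) * ∑ p : Fin (F.rk i), genHilb n (F.deg i p)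

/-- The Krull dimension of a module read off from its Hilbert polynomial:
`0` for the zero polynomial (finite length), `deg + 1` otherwise. -/
def polyDim (P : Polynomial ℚ) : ℕ := if P = 0 then 0 else P.natDegree + 1

/-- `M = coker (F₁ → F₀)` is a Cohen-Macaulay module of codimension `c`:
`F` is a minimal free resolution of length exactly `c` (so `pd M = c`, and by
Auslander–Buchsbaum `depth M = n - c`) and `dim M = n - c`. -/
def IsCMcodim (F : FreeComplex K n) (c : ℕ) : Prop :=
  IsResolution F ∧ IsMinimal F ∧ (∀ i, c < i → F.rk i = 0) ∧ F.rk c ≠ 0 ∧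
    polyDim (hilbPoly F) = n - c

/-- The multiplicity `e(M)` of a module of codimension `c`, computed from the
Betti numbers of a free resolution:
`e(M) = ((-1)^c / c!) ⬝ Σ_{i,j} (-1)^i β_{i,j} j^c`. -/
def multQ (F : FreeComplex K n) (c : ℕ) : ℚ :=
  ((-1 : ℚ) ^ c / c.factorial) *
    ∑ i ∈ Finset.range (F.len + 1),
      (-1 : ℚ) ^ i * ∑ p : Fin (F.rk i), ((F.deg i p : ℚ)) ^ c


/-- A (cohomologically indexed) finite complex of graded free `S`-modules
`0 → E⁰ → E¹ → ⋯ → E^len → 0`, where `Eⁱ = ⊕ₚ S(-deg i p)` and the (degree `0`)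
map `Eⁱ → Eⁱ⁺¹` is given by the matrix `dd i`. -/
structure CoComplex (K : Type) [Field K] (n : ℕ) where
  len : ℕ
  rk : ℕ → ℕ
  deg : (i : ℕ) → Fin (rk i) → ℤ
  dd : (i : ℕ) → Matrix (Fin (rk (i+1))) (Fin (rk i)) (PolyS K n)
  rk_eq_zero : ∀ i, len < i → rk i = 0
  isHomog : ∀ i p q, dd i p q ∈ homogZ K n (deg i q - deg (i+1) p)
  isComplex : ∀ i, dd (i+1) * dd i = 0

/-- The degree-`ℓ` part of the cocycles at cohomological position `i`. -/
def CoComplex.kerPiece (E : CoComplex K n) (i : ℕ) (ℓ : ℤ) :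
    Submodule K (Fin (E.rk i) → PolyS K n) :=
  ((LinearMap.ker ((E.dd i).mulVecLin)).restrictScalars K) ⊓ freePiece (E.deg i) ℓ

/-- The coboundaries at cohomological position `i` (as a `K`-subspace). -/
def CoComplex.imSub (E : CoComplex K n) : (i : ℕ) → Submodule K (Fin (E.rk i) → PolyS K n)
  | 0 => ⊥
  | (j+1) => (LinearMap.range ((E.dd j).mulVecLin)).restrictScalars K

/-- `dim_K (Hⁱ(E))_ℓ`, the dimension of the degree-`ℓ` component of the `i`-th
cohomology module of the complex `E`. -/
def cohomDim (E : CoComplex K n) (i : ℕ) (ℓ : ℤ) : ℕ :=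
  finrank K ((E.kerPiece i ℓ) ⧸
    (Submodule.comap (E.kerPiece i ℓ).subtype (E.imSub i)))

/-- The bilinear pairing `⟨F, E⟩ = Σ_{j ≤ i, k} (-1)^{i-j} β_{i,k}(F) ⬝ dim_K (H^j E)_{-k}`
of a free resolution `F` against a free cocomplex `E`. -/
def pairing (F : FreeComplex K n) (E : CoComplex K n) : ℤ :=
  ∑ i ∈ Finset.range (F.len + 1), ∑ j ∈ Finset.range (i + 1),
    (-1 : ℤ) ^ (i - j) * ∑ p : Fin (F.rk i), (cohomDim E j (-(F.deg i p)) : ℤ)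

/-- The modified pairing `⟨F, E⟩_{c,τ}`: terms with `j ≤ i` are kept when `j < τ`
or `j ≤ i - 2`, and the terms with `j = τ`, `i = τ + ε` (`ε ∈ {0,1}`) are kept
only when the degree `k` of the generator satisfies `k ≤ c + ε`. -/
def pairingMod (F : FreeComplex K n) (E : CoComplex K n) (c : ℤ) (τ : ℕ) : ℤ :=
  (∑ i ∈ Finset.range (F.len + 1), ∑ j ∈ Finset.range (i + 1),
    if j < τ ∨ j + 2 ≤ i then
      (-1 : ℤ) ^ (i - j) * ∑ p : Fin (F.rk i), (cohomDim E j (-(F.deg i p)) : ℤ)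
    else 0) +
  ∑ ε ∈ Finset.range 2,
    (-1 : ℤ) ^ ε * ∑ p ∈ Finset.univ.filter (fun p => F.deg (τ + ε) p ≤ c + ε),
      (cohomDim E τ (-(F.deg (τ + ε) p)) : ℤ)


/-! ### Homogeneous components in integer degrees -/

theorem mem_homogZ_iff (z : ℤ) (f : PolyS K n) :
    f ∈ homogZ K n z ↔ ∀ d, coeff d f ≠ 0 → ((d.degree : ℕ) : ℤ) = z := by
  unfold homogZ
  by_cases hz : 0 ≤ z
  · simp only [hz, iSup_pos, mem_homogeneousSubmodule]
    constructor
    · intro h d hd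
      have := h hd
      have h2 : d.degree = z.toNat := by
        rw [Finsupp.degree_eq_weight_one (R := ℕ)]
        exact this
      omega
    · intro h d hd
      have := h d hd
      have h2 : d.degree = z.toNat := by omega
      rw [Finsupp.degree_eq_weight_one (R := ℕ)] at h2
      exact h2
  · simp only [hz, iSup_false, Submodule.mem_bot]
    constructor
    · rintro rfl d hd
      simp at hd
    · intro h
      ext d
      by_contra hd
      have := h d (by simpa using hd)
      omega

/-- Projection to the component of integer degree `z`. -/
def projZ (K : Type) [Field K] (n : ℕ) (z : ℤ) : PolyS K n →ₗ[K] PolyS K n :=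
  if 0 ≤ z then homogeneousComponent z.toNat else 0

theorem coeff_projZ (z : ℤ) (f : PolyS K n) (d : Fin n →₀ ℕ) :
    coeff d (projZ K n z f) = if ((d.degree : ℕ) : ℤ) = z then coeff d f else 0 := by
  unfold projZ
  split_ifs with h1 h2 h2
  · rw [coeff_homogeneousComponent, if_pos (by omega)]
  · rw [coeff_homogeneousComponent, if_neg (by omega)]
  · omega
  · simp

theorem projZ_mem (z : ℤ) (f : PolyS K n) : projZ K n z f ∈ homogZ K n z := by
  rw [mem_homogZ_iff]
  intro d hd
  rw [coeff_projZ] at hd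
  by_contra h
  simp [h] at hd

theorem projZ_of_mem {z : ℤ} {f : PolyS K n} (hf : f ∈ homogZ K n z) : projZ K n z f = f := by
  rw [mem_homogZ_iff] at hf
  ext d
  rw [coeff_projZ]
  split_ifs with h
  · rfl
  · by_contra h2
    exact h (hf d (fun h3 => h2 h3.symm))

theorem projZ_mul {d z w : ℤ} {a : PolyS K n} (ha : a ∈ homogZ K n d) (f : PolyS K n)
    (hw : w = d + z) : projZ K n w (a * f) = a * projZ K n z f := by
  subst hw
  rw [mem_homogZ_iff] at ha
  ext m
  have hpull : ∀ (c : Prop) [Decidable c] (A : Finset ((Fin n →₀ ℕ) × (Fin n →₀ ℕ)))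
      (g : (Fin n →₀ ℕ) × (Fin n →₀ ℕ) → K),
      (if c then ∑ x ∈ A, g x else 0) = ∑ x ∈ A, if c then g x else 0 := by
    intro c _ A g
    split_ifs <;> simp
  rw [coeff_projZ, coeff_mul, coeff_mul, hpull]
  apply Finset.sum_congr rfl
  rintro ⟨x, y⟩ hxy
  rw [Finset.HasAntidiagonal.mem_antidiagonal] at hxy
  by_cases hx : coeff x a = 0
  · simp [hx]
  · have h1 := ha x hx
    have h2 : m.degree = x.degree + y.degree := by
      rw [← hxy]; simp
    rw [coeff_projZ]
    have : ((m.degree : ℕ) : ℤ) = d + z ↔ ((y.degree : ℕ) : ℤ) = z := by omega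
    simp only [this]
    split_ifs <;> simp

theorem mul_mem_homogZ {d z w : ℤ} {a f : PolyS K n} (ha : a ∈ homogZ K n d)
    (hf : f ∈ homogZ K n z) (hw : w = d + z) : a * f ∈ homogZ K n w := by
  rw [← projZ_of_mem hf, ← projZ_mul ha f hw]
  exact projZ_mem _ _

instance homogZ_finite (z : ℤ) : Module.Finite K (homogZ K n z) := by
  apply Module.Finite.iff_fg.mpr
  unfold homogZ
  by_cases hz : 0 ≤ z
  · rw [iSup_pos hz]
    exact homogeneousSubmodule_fg (Fin n) K _
  · rw [iSup_neg hz]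
    exact Submodule.fg_bot

theorem mem_freePiece {r : ℕ} (dg : Fin r → ℤ) (ℓ : ℤ) (x : Fin r → PolyS K n) :
    x ∈ freePiece dg ℓ ↔ ∀ p, x p ∈ homogZ K n (ℓ - dg p) := by
  simp [freePiece, Submodule.mem_pi]

/-- A product of submodules is the product of the underlying modules. -/
def piSubEquiv {ι : Type} {M : ι → Type} [∀ i, AddCommGroup (M i)] [∀ i, Module K (M i)]
    (N : ∀ i, Submodule K (M i)) : (Submodule.pi Set.univ N) ≃ₗ[K] (∀ i, N i) where
  toFun x i := ⟨x.1 i, x.2 i trivial⟩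
  invFun y := ⟨fun i => (y i).1, fun i _ => (y i).2⟩
  map_add' _ _ := rfl
  map_smul' _ _ := rfl
  left_inv _ := rfl
  right_inv _ := rfl

theorem finrank_piSub {ι : Type} [Fintype ι] {M : ι → Type} [∀ i, AddCommGroup (M i)]
    [∀ i, Module K (M i)] [∀ i, Module.Finite K (M i)] (N : ∀ i, Submodule K (M i)) :
    finrank K (Submodule.pi Set.univ N) = ∑ i, finrank K (N i) := by
  rw [(piSubEquiv N).finrank_eq, Module.finrank_pi_fintype]

instance freePiece_finite {r : ℕ} (dg : Fin r → ℤ) (ℓ : ℤ) :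
    Module.Finite K (freePiece (K := K) (n := n) dg ℓ) :=
  Module.Finite.equiv (piSubEquiv (K := K) fun p => homogZ K n (ℓ - dg p)).symm

/-- A homogeneous matrix commutes with taking graded pieces. -/
theorem mulVec_proj {r s : ℕ} (a : Fin r → ℤ) (b : Fin s → ℤ)
    (D : Matrix (Fin r) (Fin s) (PolyS K n))
    (hD : ∀ p q, D p q ∈ homogZ K n (b q - a p)) (ℓ : ℤ) (y : Fin s → PolyS K n) :
    D.mulVec (fun q => projZ K n (ℓ - b q) (y q)) =
      fun p => projZ K n (ℓ - a p) (D.mulVec y p) := by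
  funext p
  simp only [Matrix.mulVec, dotProduct, map_sum]
  apply Finset.sum_congr rfl
  intro q _
  rw [projZ_mul (hD p q) (y q) (z := ℓ - b q) (by ring)]

theorem mulVec_mem {r s : ℕ} (a : Fin r → ℤ) (b : Fin s → ℤ)
    (D : Matrix (Fin r) (Fin s) (PolyS K n))
    (hD : ∀ p q, D p q ∈ homogZ K n (b q - a p)) (ℓ : ℤ) (y : Fin s → PolyS K n)
    (hy : y ∈ freePiece b ℓ) : D.mulVec y ∈ freePiece a ℓ := by
  rw [mem_freePiece] at hy ⊢
  intro p
  simp only [Matrix.mulVec, dotProduct]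
  exact Submodule.sum_mem _ fun q _ => mul_mem_homogZ (hD p q) (hy q) (by ring)

theorem exists_homog_preimage {r s : ℕ} (a : Fin r → ℤ) (b : Fin s → ℤ)
    (D : Matrix (Fin r) (Fin s) (PolyS K n))
    (hD : ∀ p q, D p q ∈ homogZ K n (b q - a p)) (ℓ : ℤ) (x : Fin r → PolyS K n)
    (hx : x ∈ freePiece a ℓ) (hr : x ∈ LinearMap.range D.mulVecLin) :
    ∃ y ∈ freePiece b ℓ, D.mulVec y = x := by
  obtain ⟨y, rfl⟩ := hr
  refine ⟨fun q => projZ K n (ℓ - b q) (y q), ?_, ?_⟩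
  · rw [mem_freePiece]
    exact fun q => projZ_mem _ _
  · rw [mulVec_proj a b D hD]
    rw [mem_freePiece] at hx
    funext p
    exact projZ_of_mem (hx p)

/-- The degree `ℓ` part of a homogeneous matrix. -/
def pieceMap {r s : ℕ} (a : Fin r → ℤ) (b : Fin s → ℤ)
    (D : Matrix (Fin r) (Fin s) (PolyS K n))
    (hD : ∀ p q, D p q ∈ homogZ K n (b q - a p)) (ℓ : ℤ) :
    (freePiece (K := K) (n := n) b ℓ) →ₗ[K] (freePiece (K := K) (n := n) a ℓ) :=
  LinearMap.restrict (D.mulVecLin.restrictScalars K) (fun y hy => mulVec_mem a b D hD ℓ y hy)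

theorem pieceMap_coe {r s : ℕ} (a : Fin r → ℤ) (b : Fin s → ℤ)
    (D : Matrix (Fin r) (Fin s) (PolyS K n))
    (hD : ∀ p q, D p q ∈ homogZ K n (b q - a p)) (ℓ : ℤ)
    (y : freePiece (K := K) (n := n) b ℓ) :
    (pieceMap a b D hD ℓ y : Fin r → PolyS K n) = D.mulVec y.1 := rfl

/-! ### Cohomology dimensions -/

/-- The degree `ℓ` part of the differential of `E`. -/
def eMap (E : CoComplex K n) (j : ℕ) (ℓ : ℤ) :
    (freePiece (K := K) (n := n) (E.deg j) ℓ) →ₗ[K]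
      (freePiece (K := K) (n := n) (E.deg (j+1)) ℓ) :=
  pieceMap (E.deg (j+1)) (E.deg j) (E.dd j) (E.isHomog j) ℓ

theorem finrank_comap_of_le {V : Type} [AddCommGroup V] [Module K V] (P Q : Submodule K V) :
    finrank K (Submodule.comap P.subtype Q) = finrank K (P ⊓ Q : Submodule K V) := by
  have : Submodule.comap P.subtype Q = Submodule.comap P.subtype (P ⊓ Q) := by
    ext x
    simp
  rw [this]
  exact (Submodule.comapSubtypeEquivOfLe inf_le_left).finrank_eq

theorem kerPiece_eq (E : CoComplex K n) (i : ℕ) (ℓ : ℤ) :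
    E.kerPiece i ℓ = (LinearMap.ker (eMap E i ℓ)).map (freePiece (E.deg i) ℓ).subtype := by
  ext x
  simp only [CoComplex.kerPiece, Submodule.mem_inf, Submodule.restrictScalars_mem,
    LinearMap.mem_ker, Matrix.mulVecLin_apply, Submodule.mem_map]
  constructor
  · rintro ⟨h1, h2⟩
    exact ⟨⟨x, h2⟩, Subtype.ext h1, rfl⟩
  · rintro ⟨y, hy, rfl⟩
    exact ⟨congrArg Subtype.val hy, y.2⟩

theorem range_eMap_le (E : CoComplex K n) (j : ℕ) (ℓ : ℤ) :
    LinearMap.range (eMap E j ℓ) ≤ LinearMap.ker (eMap E (j+1) ℓ) := by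
  rintro _ ⟨y, rfl⟩
  apply Subtype.ext
  show (E.dd (j+1)).mulVec ((E.dd j).mulVec y.1) = 0
  rw [Matrix.mulVec_mulVec, E.isComplex, Matrix.zero_mulVec]

theorem kerPiece_inf_imSub (E : CoComplex K n) (j : ℕ) (ℓ : ℤ) :
    E.kerPiece (j+1) ℓ ⊓ E.imSub (j+1) =
      (LinearMap.range (eMap E j ℓ)).map (freePiece (E.deg (j+1)) ℓ).subtype := by
  ext x
  constructor
  · rintro ⟨⟨_, h1⟩, h2⟩
    obtain ⟨y, hy, rfl⟩ := exists_homog_preimage _ _ (E.dd j) (E.isHomog j) ℓ x h1 h2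
    exact ⟨_, ⟨⟨y, hy⟩, rfl⟩, rfl⟩
  · rintro ⟨_, ⟨y, rfl⟩, rfl⟩
    refine ⟨?_, ⟨y.1, rfl⟩⟩
    rw [kerPiece_eq]
    exact ⟨_, range_eMap_le E j ℓ ⟨y, rfl⟩, rfl⟩

instance kerPiece_finite (E : CoComplex K n) (i : ℕ) (ℓ : ℤ) :
    Module.Finite K (E.kerPiece i ℓ) := by
  rw [kerPiece_eq]
  infer_instance

theorem finrank_map_subtype' {V : Type} [AddCommGroup V] [Module K V] (P : Submodule K V)
    (Q : Submodule K P) : finrank K (Q.map P.subtype) = finrank K Q :=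
  (Submodule.equivMapOfInjective P.subtype P.subtype_injective Q).finrank_eq.symm

theorem cohomDim_zero (E : CoComplex K n) (ℓ : ℤ) :
    cohomDim E 0 ℓ + finrank K (LinearMap.range (eMap E 0 ℓ)) =
      finrank K (freePiece (K := K) (n := n) (E.deg 0) ℓ) := by
  have h := Submodule.finrank_quotient_add_finrank
    (Submodule.comap (E.kerPiece 0 ℓ).subtype (E.imSub 0))
  have h2 := (eMap E 0 ℓ).finrank_range_add_finrank_ker
  rw [finrank_comap_of_le] at h
  have h3 : finrank K (E.kerPiece 0 ℓ ⊓ E.imSub 0 : Submodule K _) = 0 := by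
    have : E.kerPiece 0 ℓ ⊓ E.imSub 0 = ⊥ := inf_bot_eq _
    rw [this, finrank_bot]
  rw [kerPiece_eq, finrank_map_subtype'] at h
  rw [kerPiece_eq] at h3
  have h4 : cohomDim E 0 ℓ = finrank K (LinearMap.ker (eMap E 0 ℓ)) := by
    rw [← h, h3, add_zero, ← kerPiece_eq]; rfl
  omega

theorem cohomDim_succ (E : CoComplex K n) (j : ℕ) (ℓ : ℤ) :
    cohomDim E (j+1) ℓ + finrank K (LinearMap.range (eMap E (j+1) ℓ)) +
      finrank K (LinearMap.range (eMap E j ℓ)) =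
      finrank K (freePiece (K := K) (n := n) (E.deg (j+1)) ℓ) := by
  have h := Submodule.finrank_quotient_add_finrank
    (Submodule.comap (E.kerPiece (j+1) ℓ).subtype (E.imSub (j+1)))
  have h2 := (eMap E (j+1) ℓ).finrank_range_add_finrank_ker
  rw [finrank_comap_of_le, kerPiece_inf_imSub, finrank_map_subtype'] at h
  have h5 : finrank K (E.kerPiece (j+1) ℓ) = finrank K (LinearMap.ker (eMap E (j+1) ℓ)) := by
    rw [kerPiece_eq, finrank_map_subtype']
  have h4 : cohomDim E (j+1) ℓ + finrank K (LinearMap.range (eMap E j ℓ)) =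
      finrank K (E.kerPiece (j+1) ℓ) := h
  omega

theorem ker_eq_range_of_cohomDim (E : CoComplex K n) (j : ℕ) (ℓ : ℤ)
    (h0 : cohomDim E (j+1) ℓ = 0) :
    LinearMap.range (eMap E j ℓ) = LinearMap.ker (eMap E (j+1) ℓ) := by
  apply Submodule.eq_of_le_of_finrank_eq (range_eMap_le E j ℓ)
  have h := cohomDim_succ E j ℓ
  have h2 := (eMap E (j+1) ℓ).finrank_range_add_finrank_ker
  omega

/-! ### The double complex -/

/-- The degree zero part of `Fᵢ ⊗ Eʲ`. -/
abbrev DC (F : FreeComplex K n) (E : CoComplex K n) (i j : ℕ) : Type :=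
  ∀ p : Fin (F.rk i), freePiece (K := K) (n := n) (E.deg j) (-(F.deg i p))

/-- The vertical maps, induced by the differential of `E`. -/
def vMap (F : FreeComplex K n) (E : CoComplex K n) (i j : ℕ) :
    DC F E i j →ₗ[K] DC F E i (j+1) :=
  LinearMap.pi fun p => eMap E j (-(F.deg i p)) ∘ₗ LinearMap.proj p

theorem hMap_mem (F : FreeComplex K n) (E : CoComplex K n) (i j : ℕ) (X : DC F E (i+1) j)
    (p : Fin (F.rk i)) :
    (∑ q, fun e => F.dd i p q * (X q).1 e) ∈
      freePiece (K := K) (n := n) (E.deg j) (-(F.deg i p)) := by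
  rw [mem_freePiece]
  intro e
  rw [Finset.sum_apply]
  refine Submodule.sum_mem _ fun q _ => ?_
  have := (mem_freePiece _ _ _).1 (X q).2 e
  exact mul_mem_homogZ (F.isHomog i p q) this (by ring)

/-- The horizontal maps, induced by the differential of `F`. -/
def hMap (F : FreeComplex K n) (E : CoComplex K n) (i j : ℕ) :
    DC F E (i+1) j →ₗ[K] DC F E i j where
  toFun X p := ⟨∑ q, fun e => F.dd i p q * (X q).1 e, hMap_mem F E i j X p⟩
  map_add' X Y := by
    funext p
    apply Subtype.ext
    funext e
    simp [mul_add, Finset.sum_add_distrib]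
  map_smul' c X := by
    funext p
    apply Subtype.ext
    funext e
    simp [Finset.smul_sum]

theorem hMap_apply (F : FreeComplex K n) (E : CoComplex K n) (i j : ℕ) (X : DC F E (i+1) j)
    (p : Fin (F.rk i)) (e : Fin (E.rk j)) :
    (hMap F E i j X p).1 e = (F.dd i).mulVec (fun q => (X q).1 e) p := by
  show (∑ q, fun e => F.dd i p q * (X q).1 e) e = _
  rw [Finset.sum_apply]
  rfl

theorem vMap_apply (F : FreeComplex K n) (E : CoComplex K n) (i j : ℕ) (X : DC F E i j)
    (p : Fin (F.rk i)) (e : Fin (E.rk (j+1))) :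
    (vMap F E i j X p).1 e = ∑ e', E.dd j e e' * (X p).1 e' := rfl

theorem hv_comm (F : FreeComplex K n) (E : CoComplex K n) (i j : ℕ) :
    hMap F E i (j+1) ∘ₗ vMap F E (i+1) j = vMap F E i j ∘ₗ hMap F E i j := by
  apply LinearMap.ext
  intro X
  funext p
  apply Subtype.ext
  funext e
  simp only [LinearMap.comp_apply, hMap_apply, vMap_apply, Matrix.mulVec, dotProduct,
    Finset.mul_sum]
  rw [Finset.sum_comm]
  refine Finset.sum_congr rfl fun _ _ => Finset.sum_congr rfl fun _ _ => ?_
  ring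

theorem column_mem (F : FreeComplex K n) (E : CoComplex K n) (i j : ℕ) (X : DC F E i j)
    (e : Fin (E.rk j)) :
    (fun q => (X q).1 e) ∈ freePiece (K := K) (n := n) (F.deg i) (-(E.deg j e)) := by
  rw [mem_freePiece]
  intro q
  have := (mem_freePiece _ _ _).1 (X q).2 e
  rwa [show -(E.deg j e) - F.deg i q = -(F.deg i q) - E.deg j e by ring]

theorem mem_range_hMap (F : FreeComplex K n) (E : CoComplex K n) (i j : ℕ) (X : DC F E i j)
    (h : ∀ e, (fun q => (X q).1 e) ∈ LinearMap.range (F.dd i).mulVecLin) :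
    X ∈ LinearMap.range (hMap F E i j) := by
  choose y hy hy2 using fun e => exists_homog_preimage _ _ (F.dd i) (F.isHomog i)
    (-(E.deg j e)) _ (column_mem F E i j X e) (h e)
  refine ⟨fun q => ⟨fun e => y e q, ?_⟩, ?_⟩
  · rw [mem_freePiece]
    intro e
    have := (mem_freePiece _ _ _).1 (hy e) q
    rwa [show -(F.deg (i+1) q) - E.deg j e = -(E.deg j e) - F.deg (i+1) q by ring]
  · funext p
    apply Subtype.ext
    funext e
    rw [hMap_apply]
    exact congrFun (hy2 e) p

theorem h_exact (F : FreeComplex K n) (hF : IsResolution F) (E : CoComplex K n) (i j : ℕ) :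
    LinearMap.ker (hMap F E i j) = LinearMap.range (hMap F E (i+1) j) := by
  apply le_antisymm
  · intro X hX
    apply mem_range_hMap
    intro e
    rw [← hF i, LinearMap.mem_ker, Matrix.mulVecLin_apply]
    funext p
    rw [← hMap_apply, LinearMap.mem_ker.1 hX]
    rfl
  · rintro _ ⟨Y, rfl⟩
    rw [LinearMap.mem_ker]
    funext p
    apply Subtype.ext
    funext e
    rw [hMap_apply]
    have : (fun q => (hMap F E (i+1) j Y q).1 e) =
        (F.dd (i+1)).mulVec (fun q => (Y q).1 e) := by
      funext q
      rw [hMap_apply]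
    rw [this, Matrix.mulVec_mulVec, F.isComplex, Matrix.zero_mulVec]
    rfl

theorem h_surj (F : FreeComplex K n) (E : CoComplex K n)
    (h : ∀ p : Fin (E.rk 0), MPieceDim F (-(E.deg 0 p)) = 0) :
    LinearMap.range (hMap F E 0 0) = ⊤ := by
  rw [eq_top_iff]
  intro X _
  apply mem_range_hMap
  intro e
  have h1 := h e
  unfold MPieceDim at h1
  have h2 := Module.finrank_zero_iff.1 h1
  have h3 := (Submodule.Quotient.subsingleton_iff).1 h2
  have h4 : (⟨_, column_mem F E 0 0 X e⟩ :
    freePiece (K := K) (n := n) (F.deg 0) (-(E.deg 0 e))) ∈ _ := h3 ▸ Submodule.mem_top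
  exact h4

theorem v_exact (F : FreeComplex K n) (E : CoComplex K n) (i j : ℕ)
    (h : ∀ p, cohomDim E (j+1) (-(F.deg i p)) = 0) :
    LinearMap.range (vMap F E i j) = LinearMap.ker (vMap F E i (j+1)) := by
  apply le_antisymm
  · rintro _ ⟨X, rfl⟩
    rw [LinearMap.mem_ker]
    funext p
    exact range_eMap_le E j _ ⟨X p, rfl⟩
  · intro X hX
    have : ∀ p, X p ∈ LinearMap.range (eMap E j (-(F.deg i p))) := by
      intro p
      rw [ker_eq_range_of_cohomDim E j _ (h p)]
      exact congrFun hX p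
    choose Y hY using this
    exact ⟨Y, funext hY⟩

theorem finrank_range_vMap (F : FreeComplex K n) (E : CoComplex K n) (i j : ℕ) :
    finrank K (LinearMap.range (vMap F E i j)) =
      ∑ p, finrank K (LinearMap.range (eMap E j (-(F.deg i p)))) := by
  have : LinearMap.range (vMap F E i j) =
      Submodule.pi Set.univ (fun p => LinearMap.range (eMap E j (-(F.deg i p)))) := by
    ext X
    rw [Submodule.mem_pi]
    constructor
    · rintro ⟨Y, rfl⟩ p _
      exact ⟨Y p, rfl⟩
    · intro h
      choose Y hY using fun p => h p trivial
      exact ⟨Y, funext hY⟩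
  rw [this, finrank_piSub]

/-! ### Linear algebra -/

theorem finrank_inf_ker {V W : Type} [AddCommGroup V] [Module K V] [AddCommGroup W] [Module K W]
    [Module.Finite K V] (f : V →ₗ[K] W) (A : Submodule K V) :
    finrank K (A.map f) + finrank K (A ⊓ LinearMap.ker f : Submodule K V) = finrank K A := by
  have h := (f.domRestrict A).finrank_range_add_finrank_ker
  rw [LinearMap.range_domRestrict, LinearMap.ker_domRestrict] at h
  rw [← finrank_comap_of_le]
  exact h

/-- The numerical core. -/
theorem numerics (H v r s : ℕ → ℕ → ℤ) (t : ℕ → ℤ)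
    (hH0 : ∀ i, H i 0 = v i 0 - s i 0)
    (hH : ∀ i j, H i (j+1) = v i (j+1) - s i (j+1) - s i j)
    (hv0 : v 0 0 = r 0 0)
    (hv : ∀ i j, v (i+1) j = r i j + r (i+1) j)
    (ht0 : r 0 1 - s 0 0 = t 0)
    (ht : ∀ j, r (j+1) (j+2) - s (j+1) (j+1) = t (j+1) - t j) (m : ℕ) :
    ∑ i ∈ Finset.range (m+1), ∑ j ∈ Finset.range (i+1), (-1 : ℤ)^(i+j) * H i j =
      (∑ j ∈ Finset.range (m+1), (-1 : ℤ)^(m+j) * r m j) + t m - r m (m+1) := by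
  have inner : ∀ i k, ∑ j ∈ Finset.range (k+1), (-1 : ℤ)^(i+j) * H i j =
      (∑ j ∈ Finset.range (k+1), (-1 : ℤ)^(i+j) * v i j) - (-1 : ℤ)^(i+k) * s i k := by
    intro i k
    induction k with
    | zero => simp [hH0]; ring
    | succ k ih =>
      rw [Finset.sum_range_succ, ih, Finset.sum_range_succ _ (k+1), hH]
      ring
  have sq : ∀ i : ℕ, (-1 : ℤ)^(i+i) = 1 := fun i => Even.neg_one_pow ⟨i, rfl⟩
  induction m with
  | zero => simp [hH0, hv0, ← ht0]; ring
  | succ m ih =>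
    rw [Finset.sum_range_succ, ih, inner, sq]
    have h1 : ∑ j ∈ Finset.range (m+1+1), (-1 : ℤ)^(m+1+j) * v (m+1) j =
        (∑ j ∈ Finset.range (m+1+1), (-1 : ℤ)^(m+1+j) * r (m+1) j) -
          (∑ j ∈ Finset.range (m+1), (-1 : ℤ)^(m+j) * r m j) + r m (m+1) := by
      simp only [hv, mul_add, Finset.sum_add_distrib]
      rw [Finset.sum_range_succ (fun j => (-1 : ℤ)^(m+1+j) * r m j), sq]
      have : ∑ j ∈ Finset.range (m+1), (-1 : ℤ)^(m+1+j) * r m j =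
          - ∑ j ∈ Finset.range (m+1), (-1 : ℤ)^(m+j) * r m j := by
        rw [← Finset.sum_neg_distrib]
        exact Finset.sum_congr rfl fun j _ => by ring
      rw [this]; ring
    rw [h1]
    have := ht m
    linarith

/-- Let `E : 0 → E⁰ → ⋯ → Eⁿ → 0` be a complex of graded free
`S`-modules and `F` a graded free resolution of the finitely generated graded
module `M = coker (F₁ → F₀)`. Suppose `M` and the cohomology modules `H^j(E)`
for `j > 0` have finite length, `0 > reg M + reg E⁰`, and
`0 > reg F_{j-1} + reg H^j(E)` for every `j > 0`. Then `⟨F, E⟩ = 0`.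
(For a finite length module, `reg` is the top nonvanishing degree, and for a
graded free module it is the maximal degree of a generator; the regularity
hypotheses are stated in that unfolded form.) -/
theorem pairing_vanishes (K : Type) [Field K] (n : ℕ)
    (F : FreeComplex K n) (hF : IsResolution F)
    (E : CoComplex K n) (hE : E.len ≤ n)
    (hMfin : {ℓ : ℤ | MPieceDim F ℓ ≠ 0}.Finite)
    (hHfin : ∀ j : ℕ, {ℓ : ℤ | cohomDim E (j + 1) ℓ ≠ 0}.Finite)
    (hreg0 : ∀ ℓ : ℤ, MPieceDim F ℓ ≠ 0 → ∀ p : Fin (E.rk 0), ℓ + E.deg 0 p < 0)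
    (hregj : ∀ (j : ℕ) (p : Fin (F.rk j)) (ℓ : ℤ),
      cohomDim E (j + 1) ℓ ≠ 0 → F.deg j p + ℓ < 0) :
    pairing F E = 0 := by
  classical
  have hM : ∀ p : Fin (E.rk 0), MPieceDim F (-(E.deg 0 p)) = 0 := by
    intro p
    by_contra h
    have := hreg0 _ h p
    omega
  have hC : ∀ (j : ℕ) (p : Fin (F.rk j)), cohomDim E (j+1) (-(F.deg j p)) = 0 := by
    intro j p
    by_contra h
    have := hregj j p _ h
    omega
  have hempty : IsEmpty (Fin (F.rk (F.len + 1))) := by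
    rw [F.rk_eq_zero _ (Nat.lt_succ_self _)]
    infer_instance
  let H : ℕ → ℕ → ℤ := fun i j => ∑ p : Fin (F.rk i), (cohomDim E j (-(F.deg i p)) : ℤ)
  let v : ℕ → ℕ → ℤ := fun i j => (finrank K (DC F E i j) : ℤ)
  let r : ℕ → ℕ → ℤ := fun i j => (finrank K (LinearMap.range (hMap F E i j)) : ℤ)
  let s : ℕ → ℕ → ℤ := fun i j => (finrank K (LinearMap.range (vMap F E i j)) : ℤ)
  let t : ℕ → ℤ := fun j =>
    (finrank K ((LinearMap.range (hMap F E j (j+1))).map (vMap F E j (j+1))) : ℤ)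
  have hvE : ∀ i j, v i j = ∑ p : Fin (F.rk i),
      (finrank K (freePiece (K := K) (n := n) (E.deg j) (-(F.deg i p))) : ℤ) := by
    intro i j
    simp only [v]
    rw [Module.finrank_pi_fintype]
    push_cast
    rfl
  have hsE : ∀ i j, s i j = ∑ p : Fin (F.rk i),
      (finrank K (LinearMap.range (eMap E j (-(F.deg i p)))) : ℤ) := by
    intro i j
    simp only [s]
    rw [finrank_range_vMap]
    push_cast
    rfl
  have key := numerics H v r s t ?_ ?_ ?_ ?_ ?_ ?_ F.len
  · have hr : ∀ j, r F.len j = 0 := by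
      intro j
      simp only [r]
      have h1 := (hMap F E F.len j).finrank_range_le
      rw [Module.finrank_zero_of_subsingleton (M := DC F E (F.len + 1) j)] at h1
      omega
    have ht : t F.len = 0 := by
      simp only [t]
      have h1 := Submodule.finrank_map_le (vMap F E F.len (F.len+1))
        (LinearMap.range (hMap F E F.len (F.len+1)))
      have h2 := hr (F.len + 1)
      simp only [r] at h2
      omega
    rw [ht, hr] at key
    simp only [hr, mul_zero, Finset.sum_const_zero, add_zero, sub_zero] at key
    rw [← key]
    unfold pairing
    refine Finset.sum_congr rfl fun i _ => Finset.sum_congr rfl fun j hj => ?_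
    have hj' : j ≤ i := Nat.lt_succ_iff.1 (Finset.mem_range.1 hj)
    have : (-1 : ℤ)^(i - j) = (-1 : ℤ)^(i + j) := by
      obtain ⟨k, rfl⟩ := Nat.exists_eq_add_of_le hj'
      rw [Nat.add_sub_cancel_left, show j + k + j = k + (j + j) by ring, pow_add,
        Even.neg_one_pow (n := j + j) ⟨j, rfl⟩, mul_one]
    rw [this]
  · intro i
    rw [hvE, hsE, ← Finset.sum_sub_distrib]
    refine Finset.sum_congr rfl fun p _ => ?_
    have := cohomDim_zero E (-(F.deg i p))
    omega
  · intro i j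
    rw [hvE, hsE, hsE, ← Finset.sum_sub_distrib, ← Finset.sum_sub_distrib]
    refine Finset.sum_congr rfl fun p _ => ?_
    have := cohomDim_succ E j (-(F.deg i p))
    omega
  · simp only [v, r]
    rw [h_surj F E hM, finrank_top]
  · intro i j
    simp only [v, r]
    have := (hMap F E i j).finrank_range_add_finrank_ker
    rw [h_exact F hF] at this
    omega
  · have h2 : LinearMap.range (hMap F E 0 1) ⊓ LinearMap.ker (vMap F E 0 1) =
        LinearMap.range (vMap F E 0 0) := by
      have h3 := v_exact F E 0 0 (hC 0)
      refine Eq.trans (congrArg _ h3.symm) (inf_eq_right.2 ?_)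
      rintro _ ⟨X, rfl⟩
      obtain ⟨Y, rfl⟩ : X ∈ LinearMap.range (hMap F E 0 0) := by
        rw [h_surj F E hM]; trivial
      exact ⟨vMap F E 1 0 Y, LinearMap.congr_fun (hv_comm F E 0 0) Y⟩
    have h1 := finrank_inf_ker (vMap F E 0 1) (LinearMap.range (hMap F E 0 1))
    rw [h2] at h1
    have h4 : t 0 + s 0 0 = r 0 1 := congrArg (Nat.cast : ℕ → ℤ) h1
    linarith
  · intro j
    have h1 := finrank_inf_ker (vMap F E (j+1) (j+2)) (LinearMap.range (hMap F E (j+1) (j+2)))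
    have h2 := finrank_inf_ker (hMap F E j (j+2)) (LinearMap.range (vMap F E (j+1) (j+1)))
    have h3 : (LinearMap.range (vMap F E (j+1) (j+1))).map (hMap F E j (j+2)) =
        (LinearMap.range (hMap F E j (j+1))).map (vMap F E j (j+1)) := by
      rw [← LinearMap.range_comp, ← LinearMap.range_comp]
      exact congrArg LinearMap.range (hv_comm F E j (j+1))
    have h4 : LinearMap.range (vMap F E (j+1) (j+1)) ⊓ LinearMap.ker (hMap F E j (j+2)) =
        LinearMap.range (hMap F E (j+1) (j+2)) ⊓ LinearMap.ker (vMap F E (j+1) (j+2)) := by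
      rw [h_exact F hF, v_exact F E (j+1) (j+1) (hC (j+1)), inf_comm]
    rw [h3, h4] at h2
    generalize hc : finrank K (LinearMap.range (hMap F E (j+1) (j+2)) ⊓
      LinearMap.ker (vMap F E (j+1) (j+2)) : Submodule K (DC F E (j+1) (j+2))) = c at h1 h2
    have h5 : t (j+1) + (c : ℤ) = r (j+1) (j+2) := by
      rw [← Nat.cast_add]
      exact congrArg (Nat.cast : ℕ → ℤ) h1
    have h6 : t j + (c : ℤ) = s (j+1) (j+1) := by
      rw [← Nat.cast_add]
      exact congrArg (Nat.cast : ℕ → ℤ) h2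
    linarith

end
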